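/- Let T be a tree with n vertices whose maximum degree satisfies Δ(T) < (√n − 3)/2. Then Oχ(T) = ⌈√n⌉. -/

import Mathlib

/-- `G` admits two orthogonal proper colourings, each using at most `k` colours:
two proper colourings such that no two distinct vertices receive the same pair of colours. -/
def HasOrthColoring {V : Type*} (G : SimpleGraph V) (k : ℕ) : Prop :=
  ∃ c₁ c₂ : V → Fin k,
    (∀ ⦃u v⦄, G.Adj u v → c₁ u ≠ c₁ v) ∧
    (∀ ⦃u v⦄, G.Adj u v → c₂ u ≠ c₂ v) ∧
    Function.Injective fun v => (c₁ v, c₂ v)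

/-- Two cells share a row or a column. -/
def CellConf {N : ℕ} (x y : Fin N × Fin N) : Prop := x.1 = y.1 ∨ x.2 = y.2

open Classical in
theorem card_cellConf {N : ℕ} (c : Fin N × Fin N) :
    (Finset.univ.filter fun y : Fin N × Fin N => CellConf y c).card ≤ 2 * N := by
  have hsub : (Finset.univ.filter fun y : Fin N × Fin N => CellConf y c) ⊆
      (Finset.univ.image fun j : Fin N => (c.1, j)) ∪
      (Finset.univ.image fun i : Fin N => (i, c.2)) := by
    rintro ⟨a, b⟩ h
    have h : a = c.1 ∨ b = c.2 := (Finset.mem_filter.1 h).2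
    simp only [Finset.mem_union, Finset.mem_image, Finset.mem_univ, true_and, Prod.mk.injEq]
    rcases h with h | h
    · left; exact ⟨b, h.symm, rfl⟩
    · right; exact ⟨a, rfl, h.symm⟩
  refine (Finset.card_le_card hsub).trans ((Finset.card_union_le _ _).trans ?_)
  have h1 := Finset.card_image_le (s := (Finset.univ : Finset (Fin N)))
    (f := fun j : Fin N => (c.1, j))
  have h2 := Finset.card_image_le (s := (Finset.univ : Finset (Fin N)))
    (f := fun i : Fin N => (i, c.2))
  simp only [Finset.card_univ, Fintype.card_fin] at h1 h2
  omega

open Classical in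
theorem extend_step {V : Type} [Fintype V] (T : SimpleGraph V) (N D : ℕ) (hD : 2 * D + 2 < N)
    (hdeg : ∀ a, (T.neighborFinset a).card ≤ D) (S : Finset V) (v u : V) (hv : v ∉ S)
    (hu : ∀ a ∈ S, T.Adj v a → a = u) (hS : S.card < N * N)
    (f : V → Fin N × Fin N) (hinj : Set.InjOn f S)
    (hf : ∀ a ∈ S, ∀ b ∈ S, T.Adj a b → ¬ CellConf (f a) (f b)) :
    ∃ g : V → Fin N × Fin N, Set.InjOn g (insert v S : Finset V) ∧
      ∀ a ∈ insert v S, ∀ b ∈ insert v S, T.Adj a b → ¬ CellConf (g a) (g b) := by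
  have symC : ∀ x y : Fin N × Fin N, CellConf x y → CellConf y x := by
    intro x y h; exact h.imp Eq.symm Eq.symm
  -- a free cell
  obtain ⟨x, hx⟩ : ∃ x, x ∉ S.image f := by
    by_contra! h
    have : S.image f = Finset.univ := Finset.eq_univ_iff_forall.2 h
    have h1 := Finset.card_image_le (s := S) (f := f)
    rw [this] at h1
    simp at h1
    omega
  have hx' : ∀ a ∈ S, f a ≠ x := fun a ha h => hx (Finset.mem_image.2 ⟨a, ha, h⟩)
  set A := S.filter fun a => CellConf (f a) x with hA
  have hAcard : A.card ≤ 2 * N := by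
    refine le_trans ?_ (card_cellConf x)
    refine Finset.card_le_card_of_injOn f ?_ ?_
    · intro a ha
      have ha : a ∈ A := ha
      simp only [hA, Finset.mem_filter] at ha
      simp [ha.2]
    · intro a ha b hb h
      exact hinj (Finset.mem_filter.1 ha).1 (Finset.mem_filter.1 hb).1 h
  set B := (Finset.univ.filter fun y : Fin N × Fin N => CellConf y (f u)) ∪
    (A.biUnion fun a => T.neighborFinset a).image f with hB
  obtain ⟨y, hy⟩ : ∃ y, y ∉ B := by
    by_contra! h
    have hBu : B = Finset.univ := Finset.eq_univ_iff_forall.2 h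
    have h1 : B.card ≤ 2 * N + 2 * N * D := by
      refine (Finset.card_union_le _ _).trans (add_le_add (card_cellConf _) ?_)
      refine Finset.card_image_le.trans ?_
      refine (Finset.card_biUnion_le_card_mul _ _ D fun a _ => hdeg a).trans ?_
      exact Nat.mul_le_mul_right _ hAcard
    rw [hBu] at h1
    simp at h1
    nlinarith
  have hyu : ¬ CellConf y (f u) := by
    intro h; apply hy; rw [hB]; simp [h]
  have hyn : ∀ a ∈ S, ∀ b ∈ S, T.Adj b a → f a = y → ¬ CellConf (f b) x := by
    intro a ha b hb hab hay hc
    apply hy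
    rw [hB]
    refine Finset.mem_union_right _ (Finset.mem_image.2 ⟨a, Finset.mem_biUnion.2 ⟨b, ?_, ?_⟩, hay⟩)
    · exact Finset.mem_filter.2 ⟨hb, hc⟩
    · simpa using hab
  let g : V → Fin N × Fin N := fun a => if a = v then y else if f a = y then x else f a
  have gv : g v = y := by simp [g]
  have gS : ∀ a ∈ S, g a = if f a = y then x else f a := by
    intro a ha
    have : a ≠ v := fun h => hv (h ▸ ha)
    simp [g, this]
  have gSy : ∀ a ∈ S, g a ≠ y := by
    intro a ha h
    rw [gS a ha] at h
    have := hx' a ha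
    split_ifs at h with h1
    · exact this (h1.trans h.symm)
    · exact h1 h
  have key : ∀ a ∈ S, T.Adj v a → ¬ CellConf y (g a) := by
    intro a ha hva
    have hau := hu a ha hva
    have : f a ≠ y := by
      intro h; apply hyu; rw [← hau, h]; exact Or.inl rfl
    rw [gS a ha, if_neg this, hau]
    exact hyu
  refine ⟨g, ?_, ?_⟩
  · intro a ha b hb h
    have ha : a ∈ insert v S := ha
    have hb : b ∈ insert v S := hb
    rcases Finset.mem_insert.1 ha with rfl | ha' <;> rcases Finset.mem_insert.1 hb with rfl | hb'
    · rfl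
    · exact absurd (h.symm.trans gv) (gSy b hb')
    · exact absurd (h.trans gv) (gSy a ha')
    · rw [gS a ha', gS b hb'] at h
      apply hinj ha' hb'
      have h1 := hx' a ha'
      have h2 := hx' b hb'
      split_ifs at h with h3 h4 h4
      · exact h3.trans h4.symm
      · exact absurd h.symm h2
      · exact absurd h h1
      · exact h
  · intro a ha b hb hab
    rcases Finset.mem_insert.1 ha with rfl | ha' <;> rcases Finset.mem_insert.1 hb with rfl | hb'
    · exact absurd hab (T.loopless.irrefl _)
    · rw [gv]; exact key b hb' hab
    · rw [gv]; exact fun h => key a ha' hab.symm (symC _ _ h)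
    · rw [gS a ha', gS b hb']
      have h0 := hf a ha' b hb' hab
      split_ifs with h3 h4 h4
      · exact absurd (h3.trans h4.symm ▸ Or.inl rfl) h0
      · exact fun h => hyn a ha' b hb' hab.symm h3 (symC _ _ h)
      · exact fun h => hyn b hb' a ha' hab h4 h
      · exact h0

theorem unique_closer {V : Type} (T : SimpleGraph V) (hconn : T.Connected)
    (hacyc : T.IsAcyclic) (r v a b : V) (ha : T.Adj v a) (hb : T.Adj v b)
    (hda : T.dist r a ≤ T.dist r v) (hdb : T.dist r b ≤ T.dist r v) : a = b := by
  classical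
  have main : ∀ a, T.Adj v a → T.dist r a ≤ T.dist r v →
      ∃ p : T.Walk r v, p.IsPath ∧ p.penultimate = a := by
    intro a ha hda
    obtain ⟨p, hp, hlen⟩ := hconn.exists_path_of_dist r a
    have hvp : v ∉ p.support := by
      intro hv
      have h1 := SimpleGraph.dist_le (p.takeUntil v hv)
      have h2 := p.length_takeUntil_lt hv ha.ne
      omega
    exact ⟨p.concat ha.symm, hp.concat hvp ha.symm, by simp⟩
  obtain ⟨p, hp, rfl⟩ := main a ha hda
  obtain ⟨q, hq, rfl⟩ := main b hb hdb
  have : p = q := congrArg Subtype.val (hacyc.path_unique ⟨p, hp⟩ ⟨q, hq⟩)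
  rw [this]

open Classical in
theorem partial_coloring {V : Type} [Fintype V] (T : SimpleGraph V) (hconn : T.Connected)
    (hacyc : T.IsAcyclic) (N D : ℕ) (hD : 2 * D + 2 < N)
    (hdeg : ∀ a, (T.neighborFinset a).card ≤ D) (hV : Fintype.card V ≤ N * N) (r : V) (m : ℕ) :
    ∀ S : Finset V, S.card = m → ∃ f : V → Fin N × Fin N, Set.InjOn f S ∧
      ∀ a ∈ S, ∀ b ∈ S, T.Adj a b → ¬ CellConf (f a) (f b) := by
  induction m with
  | zero =>
    intro S hS
    rw [Finset.card_eq_zero] at hS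
    subst hS
    exact ⟨fun _ => (⟨0, by omega⟩, ⟨0, by omega⟩), by simp, by simp⟩
  | succ m ih =>
    intro S hS
    have hne : S.Nonempty := Finset.card_pos.1 (by omega)
    obtain ⟨v, hv, hmax⟩ := Finset.exists_max_image S (fun a => T.dist r a) hne
    have hcard : (S.erase v).card = m := by rw [Finset.card_erase_of_mem hv]; omega
    obtain ⟨f, hf1, hf2⟩ := ih (S.erase v) hcard
    obtain ⟨u, hu⟩ : ∃ u, ∀ a ∈ S.erase v, T.Adj v a → a = u := by
      by_cases h : ∃ u ∈ S.erase v, T.Adj v u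
      · obtain ⟨u, hu, hvu⟩ := h
        exact ⟨u, fun a ha hva => unique_closer T hconn hacyc r v a u hva hvu
          (hmax a (Finset.mem_of_mem_erase ha)) (hmax u (Finset.mem_of_mem_erase hu))⟩
      · exact ⟨v, fun a ha hva => absurd ⟨a, ha, hva⟩ h⟩
    have hle : S.card ≤ Fintype.card V := Finset.card_le_univ S
    have := extend_step T N D hD hdeg (S.erase v) v u (Finset.notMem_erase v S) hu
      (by omega) f hf1 hf2
    rwa [Finset.insert_erase hv] at this

/-- If `T` is a tree with `n` vertices whose maximum degree satisfies
`Δ(T) < (√n - 3)/2`, then `Oχ(T) = ⌈√n⌉`. -/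
theorem orthChromatic_of_tree {V : Type} (T : SimpleGraph V) (n : ℕ)
    (hn : Nat.card V = n) (hconn : T.Connected) (hacyc : T.IsAcyclic)
    (hdeg : ∀ v : V, ((T.neighborSet v).ncard : ℝ) < (Real.sqrt n - 3) / 2) :
    IsLeast {k | HasOrthColoring T k} ⌈Real.sqrt n⌉₊ := by
  classical
  have hne : Nonempty V := hconn.nonempty
  obtain ⟨r⟩ := hne
  have hr := hdeg r
  have hpos : (0 : ℝ) ≤ ((T.neighborSet r).ncard : ℝ) := Nat.cast_nonneg _
  have hn0 : n ≠ 0 := by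
    rintro rfl
    simp at hr
    linarith
  have hfin : Finite V := Nat.finite_of_card_ne_zero (hn ▸ hn0)
  have := Fintype.ofFinite V
  have hcard : Fintype.card V = n := by rw [← hn, Nat.card_eq_fintype_card]
  set N := ⌈Real.sqrt n⌉₊ with hN
  have hsN : Real.sqrt n ≤ N := Nat.le_ceil _
  have hnN : n ≤ N * N := by
    have h1 : (n : ℝ) ≤ (N : ℝ) * N := by
      rw [← Real.mul_self_sqrt (Nat.cast_nonneg n : (0 : ℝ) ≤ n)]
      exact mul_self_le_mul_self (Real.sqrt_nonneg _) hsN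
    exact_mod_cast h1
  have hd : ∀ v, 2 * (T.neighborFinset v).card + 3 < N := by
    intro v
    have h1 := hdeg v
    have h2 : (T.neighborSet v).ncard = (T.neighborFinset v).card := by
      rw [← Set.ncard_coe_finset, SimpleGraph.coe_neighborFinset]
    rw [h2] at h1
    have h3 : (2 * (T.neighborFinset v).card + 3 : ℝ) < N := by linarith
    exact_mod_cast h3
  constructor
  · obtain ⟨f, hf1, hf2⟩ := partial_coloring T hconn hacyc N ((N - 3) / 2)
      (by have := hd r; omega) (fun a => by have := hd a; omega) (by omega) r _
      Finset.univ rfl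
    refine ⟨fun v => (f v).1, fun v => (f v).2, ?_, ?_, ?_⟩
    · intro u v h e
      exact hf2 u (Finset.mem_univ _) v (Finset.mem_univ _) h (Or.inl e)
    · intro u v h e
      exact hf2 u (Finset.mem_univ _) v (Finset.mem_univ _) h (Or.inr e)
    · intro u v h
      exact hf1 (by simp) (by simp) h
  · rintro k ⟨c₁, c₂, -, -, hinj⟩
    have h1 := Fintype.card_le_of_injective _ hinj
    simp only [Fintype.card_prod, Fintype.card_fin, hcard] at h1
    apply Nat.ceil_le.2
    apply Real.sqrt_le_iff.2
    refine ⟨Nat.cast_nonneg _, ?_⟩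
    rw [sq]
    exact_mod_cast h1
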